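/- There exists a universal constant K > 0 with the following property. Let ξ be a complex random variable with E[|ξ|³] < ∞ and E[ξ] = E[ξ²] = 0. Let F : ℂ → ℂ be twice continuously differentiable (as a function of the two real variables Re z and Im z), and let M > 0 be such that the second-order Wirtinger derivatives ∂²_z F, ∂_z ∂_{z̄} F and ∂²_{z̄} F are all bounded in absolute value by M on all of ℂ. Then |E[ξ F(ξ, ξ̄)] − E[|ξ|²] · E[∂_{z̄} F(ξ, ξ̄)]| ≤ K · M · E[|ξ|³]. -/

import Mathlib

open MeasureTheory ProbabilityTheory Real Filter Set
open scoped Topology ENNReal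

noncomputable section

/-- The uniform probability measure on the unit circle in `ℂ`, i.e. the image of the
normalized Lebesgue measure on `(0, 2π]` under `θ ↦ e^{iθ}`. -/
def circleUniform : Measure ℂ :=
  Measure.map (fun θ : ℝ => Complex.exp (θ * Complex.I))
    ((ENNReal.ofReal (2 * Real.pi))⁻¹ • volume.restrict (Ioc (0:ℝ) (2 * Real.pi)))

/-- The finite set of primes `p ≤ T`. -/
def primesLe (T : ℝ) : Finset ℕ := (Finset.range (Nat.floor T + 1)).filter Nat.Prime

/-- The finite set of primes `p` with `log p ≤ (log T)^α`. -/
def primesScale (T α : ℝ) : Finset ℕ :=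
  (Finset.range (Nat.floor T + 1)).filter
    fun p => Nat.Prime p ∧ Real.log p ≤ (Real.log T) ^ α

/-- The finite set of primes `p` with `(log T)^{α₁} < log p ≤ (log T)^{α₂}`. -/
def primesBetween (T α₁ α₂ : ℝ) : Finset ℕ :=
  (Finset.range (Nat.floor T + 1)).filter
    fun p => Nat.Prime p ∧ (Real.log T) ^ α₁ < Real.log p ∧ Real.log p ≤ (Real.log T) ^ α₂

variable {Ω : Type*} [MeasurableSpace Ω]

/-- The random model `X_h = ∑_{p ≤ T} Re(U_p p^{-ih})/√p` of the zeta function. -/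
def Xp (U : ℕ → Ω → ℂ) (T h : ℝ) (ω : Ω) : ℝ :=
  ∑ p ∈ primesLe T, (U p ω * (p : ℂ) ^ (-(Complex.I * (h:ℂ)))).re / Real.sqrt p

/-- The truncated process `X_h(α) = ∑_{log p ≤ (log T)^α} Re(U_p p^{-ih})/√p`. -/
def Xscale (U : ℕ → Ω → ℂ) (T α h : ℝ) (ω : Ω) : ℝ :=
  ∑ p ∈ primesScale T α, (U p ω * (p : ℂ) ^ (-(Complex.I * (h:ℂ)))).re / Real.sqrt p

/-- The increment `X_h(α₁,α₂) = X_h(α₂) − X_h(α₁)`. -/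
def Xincr (U : ℕ → Ω → ℂ) (T α₁ α₂ h : ℝ) (ω : Ω) : ℝ :=
  Xscale U T α₂ h ω - Xscale U T α₁ h ω

/-- The perturbed process `X̃_h = (1+u) X_h(α) + (X_h − X_h(α))`. -/
def Xtilde (U : ℕ → Ω → ℂ) (T u α h : ℝ) (ω : Ω) : ℝ :=
  (1 + u) * Xscale U T α h ω + (Xp U T h ω - Xscale U T α h ω)

/-- The overlap (correlation coefficient)
`ρ(h,h') = E[X_h X_{h'}]/(E[X_h²] E[X_{h'}²])^{1/2}`. -/
def overlap (P : Measure Ω) (U : ℕ → Ω → ℂ) (T h h' : ℝ) : ℝ :=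
  (∫ ω, Xp U T h ω * Xp U T h' ω ∂P) /
    Real.sqrt ((∫ ω, (Xp U T h ω) ^ 2 ∂P) * (∫ ω, (Xp U T h' ω) ^ 2 ∂P))

/-- The partition function `Z_{β,T} = ∫_0^1 e^{β X_h} dh`. -/
def gibbsZ (U : ℕ → Ω → ℂ) (β T : ℝ) (ω : Ω) : ℝ :=
  ∫ h in Icc (0:ℝ) 1, Real.exp (β * Xp U T h ω)

/-- The integral `∫∫ g(h,h') dG_{β,T}^{×2}(h,h')` of a function `g` of two points sampled
independently from the Gibbs measure `G_{β,T}`. -/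
def gibbsPair (U : ℕ → Ω → ℂ) (β T : ℝ) (g : ℝ → ℝ → ℝ) (ω : Ω) : ℝ :=
  (∫ h in Icc (0:ℝ) 1, ∫ h' in Icc (0:ℝ) 1,
      g h h' * Real.exp (β * Xp U T h ω) * Real.exp (β * Xp U T h' ω)) /
    (gibbsZ U β T ω) ^ 2

/-- The free energy `F_T(β; α, u)` of the perturbed process `X_h + u X_h(α)`. -/
def freeEnergy (P : Measure Ω) (U : ℕ → Ω → ℂ) (β α u T : ℝ) : ℝ :=
  ∫ ω, Real.log (∫ h in Icc (0:ℝ) 1,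
      Real.exp (β * (Xp U T h ω + u * Xscale U T α h ω))) ∂P

/-- The limiting free energy `f(β, σ²)` of a REM with variance parameter `σ²`;
here the argument is `σ`. -/
def fREM (β σ : ℝ) : ℝ := if β ≤ 2 / σ then β ^ 2 * σ ^ 2 / 4 else β * σ - 1

/-- The critical level `γ*` of the maximum of the perturbed process. -/
def gammaStar (u α : ℝ) : ℝ :=
  if u ≤ 0 then Real.sqrt ((1 + u) ^ 2 * α + (1 - α)) else (1 + u) * α + (1 - α)

/-- The normalized log-measure of `γ`-high points
`ℰ_{α,u}(γ;T) = (log Leb{h ∈ [0,1] : X̃_h > γ log log T})/(log log T)`. -/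
def logMeasHigh (U : ℕ → Ω → ℂ) (T u α γ : ℝ) (ω : Ω) : ℝ :=
  Real.log ((volume {h : ℝ | h ∈ Icc (0:ℝ) 1 ∧
      γ * Real.log (Real.log T) < Xtilde U T u α h ω}).toReal) / Real.log (Real.log T)

/-- The sum `∑_{P ≤ p ≤ Q} cos(Δ log p)/p` over primes. -/
def primeCosSum (P Q Δ : ℝ) : ℝ :=
  ∑ p ∈ (Finset.range (Nat.floor Q + 1)).filter (fun p => Nat.Prime p ∧ P ≤ (p:ℝ)),
    Real.cos (Δ * Real.log p) / p

/-- The Wirtinger derivative `∂_z = (∂_x − i ∂_y)/2` of `F : ℂ → ℂ` (as a function of the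
two real variables `x = Re z`, `y = Im z`). -/
def wirtingerD (F : ℂ → ℂ) (z : ℂ) : ℂ :=
  (fderiv ℝ F z 1 - Complex.I * fderiv ℝ F z Complex.I) / 2

/-- The Wirtinger derivative `∂_{z̄} = (∂_x + i ∂_y)/2` of `F : ℂ → ℂ`. -/
def wirtingerDbar (F : ℂ → ℂ) (z : ℂ) : ℂ :=
  (fderiv ℝ F z 1 + Complex.I * fderiv ℝ F z Complex.I) / 2

/-- The normalized log-partition function
`f_T = (log ∫_0^1 exp(β(X_h + u X_h(α))) dh)/(log log T)`. -/
def fTnorm (U : ℕ → Ω → ℂ) (β u α T : ℝ) (ω : Ω) : ℝ :=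
  Real.log (∫ h in Icc (0:ℝ) 1,
      Real.exp (β * (Xp U T h ω + u * Xscale U T α h ω))) / Real.log (Real.log T)

/-- The real derivative of `G` in terms of its Wirtinger derivatives. -/
lemma fderiv_eq_wirtinger (G : ℂ → ℂ) (z v : ℂ) :
    fderiv ℝ G z v = wirtingerD G z * v + wirtingerDbar G z * starRingEnd ℂ v := by
  have hv : v = v.re • (1 : ℂ) + v.im • Complex.I := by
    simp [Complex.re_add_im]
  have h : fderiv ℝ G z v = v.re * fderiv ℝ G z 1 + v.im * fderiv ℝ G z Complex.I := by
    conv_lhs => rw [hv]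
    rw [map_add, map_smul, map_smul, Complex.real_smul, Complex.real_smul]
  have hc : starRingEnd ℂ v = v.re - v.im * Complex.I := by
    apply Complex.ext <;> simp
  have hv' : v = v.re + v.im * Complex.I := (Complex.re_add_im v).symm
  rw [h, hc]
  conv_rhs => rw [show wirtingerD G z * v
    = wirtingerD G z * (v.re + v.im * Complex.I) from by rw [← hv']]
  unfold wirtingerD wirtingerDbar
  linear_combination ((v.im : ℂ) * fderiv ℝ G z Complex.I) * Complex.I_sq

lemma norm_fderiv_le_wirtinger {G : ℂ → ℂ} {z : ℂ} {a b : ℝ}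
    (ha : ‖wirtingerD G z‖ ≤ a) (hb : ‖wirtingerDbar G z‖ ≤ b) :
    ‖fderiv ℝ G z‖ ≤ a + b := by
  have ha0 : 0 ≤ a := (norm_nonneg _).trans ha
  have hb0 : 0 ≤ b := (norm_nonneg _).trans hb
  refine ContinuousLinearMap.opNorm_le_bound _ (by positivity) fun v => ?_
  rw [fderiv_eq_wirtinger, add_mul]
  refine (norm_add_le _ _).trans ?_
  rw [norm_mul, norm_mul, RCLike.norm_conj]
  gcongr

lemma contDiff_fderiv_apply_const {F : ℂ → ℂ} (hF : ContDiff ℝ 2 F) (v : ℂ) :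
    ContDiff ℝ 1 fun z => fderiv ℝ F z v :=
  (hF.fderiv_right (m := 1) (by norm_num)).clm_apply contDiff_const

lemma contDiff_wirtingerD {F : ℂ → ℂ} (hF : ContDiff ℝ 2 F) : ContDiff ℝ 1 (wirtingerD F) :=
  ((contDiff_fderiv_apply_const hF 1).sub
    (contDiff_const.mul (contDiff_fderiv_apply_const hF Complex.I))).div_const 2

lemma contDiff_wirtingerDbar {F : ℂ → ℂ} (hF : ContDiff ℝ 2 F) :
    ContDiff ℝ 1 (wirtingerDbar F) :=
  ((contDiff_fderiv_apply_const hF 1).add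
    (contDiff_const.mul (contDiff_fderiv_apply_const hF Complex.I))).div_const 2

/-- Mixed Wirtinger derivatives of a `C²` function commute. -/
lemma wirtingerD_wirtingerDbar {F : ℂ → ℂ} (hF : ContDiff ℝ 2 F) (z : ℂ) :
    wirtingerD (wirtingerDbar F) z = wirtingerDbar (wirtingerD F) z := by
  have hd : DifferentiableAt ℝ (fderiv ℝ F) z :=
    (hF.fderiv_right (m := 1) (by norm_num)).differentiable (by norm_num) z
  have hsymm : IsSymmSndFDerivAt ℝ F z :=
    hF.contDiffAt.isSymmSndFDerivAt (by simp)
  have happ (w : ℂ) : HasFDerivAt (fun y => fderiv ℝ F y w)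
      ((ContinuousLinearMap.apply ℝ ℂ w).comp (fderiv ℝ (fderiv ℝ F) z)) z :=
    (ContinuousLinearMap.apply ℝ ℂ w).hasFDerivAt.comp z hd.hasFDerivAt
  have hD (v : ℂ) : fderiv ℝ (wirtingerD F) z v =
      (fderiv ℝ (fderiv ℝ F) z v 1 - Complex.I * fderiv ℝ (fderiv ℝ F) z v Complex.I) / 2 := by
    have := (((happ 1).sub ((happ Complex.I).const_mul Complex.I)).mul_const (2⁻¹ : ℂ)).fderiv
    have h2 : wirtingerD F =
        fun y => (fderiv ℝ F y 1 - Complex.I * fderiv ℝ F y Complex.I) * 2⁻¹ := by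
      funext y; simp [wirtingerD, div_eq_mul_inv]
    rw [h2]
    erw [this]
    simp
    ring
  have hDbar (v : ℂ) : fderiv ℝ (wirtingerDbar F) z v =
      (fderiv ℝ (fderiv ℝ F) z v 1 + Complex.I * fderiv ℝ (fderiv ℝ F) z v Complex.I) / 2 := by
    have := (((happ 1).add ((happ Complex.I).const_mul Complex.I)).mul_const (2⁻¹ : ℂ)).fderiv
    have h2 : wirtingerDbar F =
        fun y => (fderiv ℝ F y 1 + Complex.I * fderiv ℝ F y Complex.I) * 2⁻¹ := by
      funext y; simp [wirtingerDbar, div_eq_mul_inv]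
    rw [h2]
    erw [this]
    simp
    ring
  rw [wirtingerD, wirtingerDbar, hD, hD, hDbar, hDbar, hsymm.eq Complex.I 1]
  ring

lemma norm_sub_apply_zero_le_of_norm_wirtinger_le {G : ℂ → ℂ} (hG : Differentiable ℝ G) {a b : ℝ}
    (ha : ∀ z, ‖wirtingerD G z‖ ≤ a) (hb : ∀ z, ‖wirtingerDbar G z‖ ≤ b) (z : ℂ) :
    ‖G z - G 0‖ ≤ (a + b) * ‖z‖ := by
  simpa using convex_univ.norm_image_sub_le_of_norm_fderiv_le (𝕜 := ℝ) (fun x _ => hG x)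
    (fun x _ => norm_fderiv_le_wirtinger (ha x) (hb x)) (mem_univ 0) (mem_univ z)

/-- First-order Taylor expansion at `0` with a quadratic remainder, when the Wirtinger
derivatives have linear growth around their value at `0`. -/
lemma norm_sub_taylor_le_of_wirtinger {F : ℂ → ℂ} (hF : Differentiable ℝ F) {C : ℝ} (hC : 0 ≤ C)
    (hg : ∀ z, ‖wirtingerD F z - wirtingerD F 0‖ ≤ C * ‖z‖)
    (hh : ∀ z, ‖wirtingerDbar F z - wirtingerDbar F 0‖ ≤ C * ‖z‖) (z : ℂ) :
    ‖F z - (F 0 + wirtingerD F 0 * z + wirtingerDbar F 0 * starRingEnd ℂ z)‖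
      ≤ 2 * C * ‖z‖ ^ 2 := by
  have key := (convex_closedBall (0 : ℂ) ‖z‖).norm_image_sub_le_of_norm_hasFDerivWithin_le' (𝕜 := ℝ)
    (f := F) (f' := fderiv ℝ F) (φ := fderiv ℝ F 0) (C := 2 * C * ‖z‖) (x := 0) (y := z)
    (fun x _ => (hF x).hasFDerivAt.hasFDerivWithinAt) (fun x hx => ?_) (by simp) (by simp)
  · rw [sub_zero, fderiv_eq_wirtinger] at key
    calc _ = _ := by congr 1; ring
      _ ≤ _ := key
      _ = _ := by ring
  · have hx' : ‖x‖ ≤ ‖z‖ := by simpa using hx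
    refine ContinuousLinearMap.opNorm_le_bound _ (by positivity) fun v => ?_
    rw [sub_apply, fderiv_eq_wirtinger, fderiv_eq_wirtinger F 0]
    calc _ = ‖(wirtingerD F x - wirtingerD F 0) * v
          + (wirtingerDbar F x - wirtingerDbar F 0) * starRingEnd ℂ v‖ := by congr 1; ring
      _ ≤ C * ‖x‖ * ‖v‖ + C * ‖x‖ * ‖v‖ := by
        refine (norm_add_le _ _).trans ?_
        rw [norm_mul, norm_mul, RCLike.norm_conj]
        gcongr
        exacts [hg x, hh x]
      _ ≤ C * ‖z‖ * ‖v‖ + C * ‖z‖ * ‖v‖ := by gcongr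
      _ = _ := by ring

/-- Correlation inequality `E[X²] E[X] ≤ E[X³]` for a nonnegative random variable. -/
lemma integral_sq_mul_integral_le_integral_cube {Ω : Type*} [MeasurableSpace Ω] {P : Measure Ω}
    [IsProbabilityMeasure P] {X : Ω → ℝ} (hX : ∀ ω, 0 ≤ X ω) (h1 : Integrable X P)
    (h2 : Integrable (fun ω => X ω ^ 2) P) (h3 : Integrable (fun ω => X ω ^ 3) P) :
    (∫ ω, X ω ^ 2 ∂P) * ∫ ω, X ω ∂P ≤ ∫ ω, X ω ^ 3 ∂P := by
  set m := ∫ ω, X ω ∂P with hm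
  have hm0 : 0 ≤ m := integral_nonneg hX
  have hle : ∫ ω, m ^ 2 * (X ω - m) ∂P ≤ ∫ ω, (X ω ^ 3 - m * X ω ^ 2) ∂P := by
    refine integral_mono ((h1.sub (integrable_const m)).const_mul _) (h3.sub (h2.const_mul m)) ?_
    intro ω
    have := mul_nonneg (sq_nonneg (X ω - m)) (add_nonneg (hX ω) hm0)
    dsimp only
    nlinarith
  rw [integral_const_mul, integral_sub h1 (integrable_const m),
    integral_sub h3 (h2.const_mul m), integral_const_mul] at hle
  simp [← hm] at hle
  linarith

/-- approximate Gaussian integration by parts for a complex random variable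
`ξ` with `E[ξ] = E[ξ²] = 0` and finite third moment, against a `C²` function `F : ℂ → ℂ`
whose second-order Wirtinger derivatives are bounded by `M`. -/
theorem approx_gaussian_integration_by_parts :
    ∃ K > (0:ℝ), ∀ (Ω : Type) [MeasurableSpace Ω] (P : Measure Ω),
      IsProbabilityMeasure P → ∀ (ξ : Ω → ℂ) (F : ℂ → ℂ) (M : ℝ),
      Measurable ξ → Integrable (fun ω => ‖ξ ω‖ ^ 3) P →
      (∫ ω, ξ ω ∂P) = 0 → (∫ ω, (ξ ω) ^ 2 ∂P) = 0 →
      ContDiff ℝ 2 F → 0 < M →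
      (∀ z, ‖wirtingerD (wirtingerD F) z‖ ≤ M) →
      (∀ z, ‖wirtingerDbar (wirtingerD F) z‖ ≤ M) →
      (∀ z, ‖wirtingerDbar (wirtingerDbar F) z‖ ≤ M) →
      ‖(∫ ω, ξ ω * F (ξ ω) ∂P)
          - ((∫ ω, ‖ξ ω‖ ^ 2 ∂P : ℝ) : ℂ) * ∫ ω, wirtingerDbar F (ξ ω) ∂P‖
        ≤ K * M * ∫ ω, ‖ξ ω‖ ^ 3 ∂P := by
  refine ⟨6, by norm_num, ?_⟩
  intro Ω _ P _ ξ F M hξ h3 hmean hsq hF hM hzz hzbz hbb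
  have hFd : Differentiable ℝ F := hF.differentiable (by norm_num)
  have hgd := (contDiff_wirtingerD hF).differentiable (by norm_num)
  have hhC := contDiff_wirtingerDbar hF
  have hhd := hhC.differentiable (by norm_num)
  have hg (z : ℂ) : ‖wirtingerD F z - wirtingerD F 0‖ ≤ 2 * M * ‖z‖ := by
    rw [two_mul]
    exact norm_sub_apply_zero_le_of_norm_wirtinger_le hgd hzz hzbz z
  have hh (z : ℂ) : ‖wirtingerDbar F z - wirtingerDbar F 0‖ ≤ 2 * M * ‖z‖ := by
    rw [two_mul]
    exact norm_sub_apply_zero_le_of_norm_wirtinger_le hhd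
      (fun z => (wirtingerD_wirtingerDbar hF z).symm ▸ hzbz z) hbb z
  have hT := norm_sub_taylor_le_of_wirtinger hFd (by positivity : 0 ≤ 2 * M) hg hh
  have h1 : Integrable ξ P := by
    refine ((integrable_const (1 : ℝ)).add h3).mono' hξ.aestronglyMeasurable (ae_of_all _ fun ω => ?_)
    have h0 := norm_nonneg (ξ ω)
    simp only [Pi.add_apply]
    nlinarith [mul_nonneg h0 (sq_nonneg (‖ξ ω‖ - 1)), sq_nonneg (‖ξ ω‖ - 1)]
  have h2 : Integrable (fun ω => ‖ξ ω‖ ^ 2) P := by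
    refine ((integrable_const (1 : ℝ)).add h3).mono' (hξ.norm.pow_const 2).aestronglyMeasurable
      (ae_of_all _ fun ω => ?_)
    have h0 := norm_nonneg (ξ ω)
    rw [Real.norm_of_nonneg (by positivity)]
    simp only [Pi.add_apply]
    nlinarith [mul_nonneg h0 (sq_nonneg (‖ξ ω‖ - 1)), sq_nonneg (‖ξ ω‖ - 1)]
  have h2' : Integrable (fun ω => ξ ω ^ 2) P :=
    h2.mono' (hξ.pow_const 2).aestronglyMeasurable (ae_of_all _ fun ω => by simp)
  have h2c : Integrable (fun ω => ((‖ξ ω‖ ^ 2 : ℝ) : ℂ)) P := h2.ofReal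
  set R : Ω → ℂ := fun ω => ξ ω *
    (F (ξ ω) - (F 0 + wirtingerD F 0 * ξ ω + wirtingerDbar F 0 * starRingEnd ℂ (ξ ω))) with hR
  have hRle (ω : Ω) : ‖R ω‖ ≤ 4 * M * ‖ξ ω‖ ^ 3 := by
    rw [hR, norm_mul]
    calc _ ≤ ‖ξ ω‖ * (2 * (2 * M) * ‖ξ ω‖ ^ 2) := by gcongr; exact hT _
      _ = _ := by ring
  have hRm : Measurable R := by
    have := hF.continuous.measurable.comp hξ
    have hc : Measurable fun ω => starRingEnd ℂ (ξ ω) := Complex.continuous_conj.measurable.comp hξ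
    exact hξ.mul (this.sub (((hξ.const_mul _).const_add _).add (hc.const_mul _)))
  have hRi : Integrable R P :=
    (h3.const_mul (4 * M)).mono' hRm.aestronglyMeasurable (ae_of_all _ hRle)
  have hmain : ∫ ω, ξ ω * F (ξ ω) ∂P
      = ∫ ω, R ω ∂P + wirtingerDbar F 0 * ((∫ ω, ‖ξ ω‖ ^ 2 ∂P : ℝ) : ℂ) := by
    have hpt (ω : Ω) : ξ ω * F (ξ ω) = R ω + F 0 * ξ ω + wirtingerD F 0 * ξ ω ^ 2
        + wirtingerDbar F 0 * ((‖ξ ω‖ ^ 2 : ℝ) : ℂ) := by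
      have : ((‖ξ ω‖ ^ 2 : ℝ) : ℂ) = ξ ω * starRingEnd ℂ (ξ ω) := by
        rw [Complex.mul_conj, Complex.normSq_eq_norm_sq]
      rw [this, hR]
      ring
    have hi₁ : Integrable (fun ω => R ω + F 0 * ξ ω) P := hRi.add (h1.const_mul _)
    have hi₂ : Integrable (fun ω => R ω + F 0 * ξ ω + wirtingerD F 0 * ξ ω ^ 2) P :=
      hi₁.add (h2'.const_mul _)
    simp_rw [hpt]
    rw [integral_add hi₂ (h2c.const_mul _), integral_add hi₁ (h2'.const_mul _),
      integral_add hRi (h1.const_mul _), integral_const_mul, integral_const_mul,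
      integral_const_mul, hmean, hsq, integral_complex_ofReal]
    ring
  have hSi : Integrable (fun ω => wirtingerDbar F (ξ ω) - wirtingerDbar F 0) P :=
    (h1.norm.const_mul (2 * M)).mono'
      ((hhC.continuous.measurable.comp hξ).sub_const _).aestronglyMeasurable
      (ae_of_all _ fun ω => hh (ξ ω))
  have hS : ∫ ω, wirtingerDbar F (ξ ω) ∂P
      = ∫ ω, (wirtingerDbar F (ξ ω) - wirtingerDbar F 0) ∂P + wirtingerDbar F 0 := by
    have := integral_add hSi (integrable_const (wirtingerDbar F 0))
    simpa using this
  have hRn : ‖∫ ω, R ω ∂P‖ ≤ 4 * M * ∫ ω, ‖ξ ω‖ ^ 3 ∂P := by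
    rw [← integral_const_mul]
    exact norm_integral_le_of_norm_le (h3.const_mul _) (ae_of_all _ hRle)
  have hSn : ‖∫ ω, (wirtingerDbar F (ξ ω) - wirtingerDbar F 0) ∂P‖
      ≤ 2 * M * ∫ ω, ‖ξ ω‖ ∂P := by
    rw [← integral_const_mul]
    exact norm_integral_le_of_norm_le (h1.norm.const_mul _) (ae_of_all _ fun ω => hh (ξ ω))
  have hcorr := integral_sq_mul_integral_le_integral_cube (fun ω => norm_nonneg (ξ ω)) h1.norm h2 h3
  have hv0 : 0 ≤ ∫ ω, ‖ξ ω‖ ^ 2 ∂P := integral_nonneg fun ω => by positivity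
  rw [hmain, hS]
  set v := ∫ ω, ‖ξ ω‖ ^ 2 ∂P
  set S := ∫ ω, (wirtingerDbar F (ξ ω) - wirtingerDbar F 0) ∂P
  calc _ = ‖∫ ω, R ω ∂P - (v : ℂ) * S‖ := by congr 1; ring
    _ ≤ ‖∫ ω, R ω ∂P‖ + v * ‖S‖ := by
      refine (norm_sub_le _ _).trans ?_
      rw [norm_mul, Complex.norm_of_nonneg hv0]
    _ ≤ 4 * M * (∫ ω, ‖ξ ω‖ ^ 3 ∂P) + v * (2 * M * ∫ ω, ‖ξ ω‖ ∂P) := by gcongr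
    _ ≤ 6 * M * ∫ ω, ‖ξ ω‖ ^ 3 ∂P := by nlinarith [mul_le_mul_of_nonneg_left hcorr hM.le]
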